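/- arXiv:1309.5301 — 3 statements merged into one kernel-verified Lean document; each statement's English description precedes it below -/
import Mathlib

section
/- Let C ≥ 1 and let a, b₁, ..., b_C be C + 1 pairwise distinct memory blocks. Let σₙ be the concatenation of n copies of the access sequence (a, a, b₁, b₂, ..., b_C). Then an LRU cache of capacity C starting from the empty state satisfies misses(σₙ, ∅) = n·(C+1): in every repetition, the first access to a and every access to each bᵢ is a miss. (This is the access pattern m_{C+1}, m_{C+1}, m₁, ..., m_C executed by the stealing processor p₁ in the parallel execution of the lower-bound DAG of Theorem 4, which incurs C·k misses over k repetitions of the Y-blocks.) -/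
variable {α : Type*} [DecidableEq α]

/-- One LRU access of block `b` on a cache state `s` (capacity `C`):
on a hit, `b` moves to the front; on a miss, `b` is placed at the front and,
if the resulting list has length `C + 1`, the last element is evicted. -/
def lruAccess (C : ℕ) (b : α) (s : List α) : List α :=
  if b ∈ s then b :: s.erase b else (b :: s).take C

/-- The cache state after processing the access sequence `σ` from state `s`. -/
def lruRun (C : ℕ) : List α → List α → List α
  | [], s => s
  | b :: σ, s => lruRun C σ (lruAccess C b s)

/-- The number of LRU misses incurred while processing the access sequence `σ`
starting from cache state `s`. -/
def lruMisses (C : ℕ) : List α → List α → ℕ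
  | [], _ => 0
  | b :: σ, s => (if b ∈ s then 0 else 1) + lruMisses C σ (lruAccess C b s)

/-- The concatenation of `n` copies of the list `l`. -/
def listReps (l : List α) : ℕ → List α
  | 0 => []
  | n + 1 => l ++ listReps l n

/-- While `l` is processed after `a` and the blocks of `d.reverse`, every access misses, because
the blocks still cached below `a` come from the most recent end of the previous pass over `l`. -/
theorem lruMisses_append_of_prefix_reverse {α : Type*} [DecidableEq α] (C : ℕ) (a : α)
    (σ l d s : List α) (hnd : (d ++ a :: l).Nodup) (hC : C = d.length + l.length)
    (hs : s <+: l.reverse) :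
    lruMisses C (l ++ σ) ((d ++ a :: s).take C)
      = l.length + lruMisses C σ (l.reverse ++ d) := by
  induction l generalizing d s with
  | nil => simp [hC]
  | cons x q ih =>
    have htake : (d ++ a :: s).take C = d ++ a :: s.take q.length := by
      simp [hC, List.take_append]
    have hpre : s.take q.length <+: q.reverse := by
      simpa using hs.take q.length
    have hx : x ∉ d ++ a :: s.take q.length := by
      have hq : x ∈ s.take q.length → x ∈ q := fun h => List.mem_reverse.1 (hpre.subset h)
      grind
    have hperm : (d ++ a :: x :: q).Perm (x :: d ++ a :: q) := by
      simpa using List.perm_middle (a := x) (l₁ := d ++ [a]) (l₂ := q)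
    have hih := ih (x :: d) (s.take q.length) (hperm.nodup hnd) (by grind) hpre
    rw [htake, List.cons_append, lruMisses, if_neg hx, lruAccess, if_neg hx, ← List.cons_append,
      hih]
    simp
    omega

/-- A pass over `a, a, l` misses on the first access to `a` and on every access to `l`. -/
theorem lruMisses_cons_cons_append {α : Type*} [DecidableEq α] (C : ℕ) (hC : 1 ≤ C) (a : α)
    (σ l s : List α) (hnd : (a :: l).Nodup) (hl : l.length = C) (hs : s <+: l.reverse) :
    lruMisses C (a :: a :: l ++ σ) s = C + 1 + lruMisses C σ l.reverse := by
  have ha : a ∉ s := fun h => (List.nodup_cons.1 hnd).1 (List.mem_reverse.1 (hs.subset h))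
  have hpass := lruMisses_append_of_prefix_reverse C a σ l [] s hnd (by simp [hl]) hs
  obtain ⟨c, rfl⟩ : ∃ c, C = c + 1 := ⟨C - 1, by omega⟩
  simp only [List.nil_append, List.take_succ_cons, List.append_nil] at hpass
  simp [lruMisses, lruAccess, ha, hpass, hl]
  omega

theorem lruMisses_listReps {α : Type*} [DecidableEq α] (C : ℕ) (hC : 1 ≤ C) (a : α)
    (l s : List α) (hnd : (a :: l).Nodup) (hl : l.length = C) (hs : s <+: l.reverse) (n : ℕ) :
    lruMisses C (listReps (a :: a :: l) n) s = n * (C + 1) := by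
  induction n generalizing s with
  | zero => simp [listReps, lruMisses]
  | succ n ih =>
    rw [listReps, lruMisses_cons_cons_append C hC a _ l s hnd hl hs, ih _ List.prefix_rfl]
    ring

/-- The access pattern of the stealing processor `p₁` in the lower-bound DAG of
Theorem 4: `n` repetitions of `(a, a, b₁, …, b_C)`, where `a, b₁, …, b_C` are
`C + 1` pairwise distinct blocks, incur exactly `n·(C + 1)` misses on an
initially empty LRU cache of capacity `C ≥ 1` (in every repetition, the first
access to `a` and every access to each `bᵢ` miss). -/
theorem lru_steal_pattern_misses {α : Type*} [DecidableEq α]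
    (C : ℕ) (hC : 1 ≤ C) (a : α) (b : Fin C → α)
    (hb : Function.Injective b) (hab : ∀ i, a ≠ b i) (n : ℕ) :
    lruMisses C (listReps (a :: a :: List.ofFn b) n) ([] : List α)
      = n * (C + 1) := by
  refine lruMisses_listReps C hC a (List.ofFn b) [] ?_ (by simp) List.nil_prefix n
  refine List.nodup_cons.2 ⟨?_, List.nodup_ofFn.2 hb⟩
  rw [List.mem_ofFn]
  rintro ⟨i, hi⟩
  exact hab i hi.symm
end

section
/- Let C ≥ 1, n ≥ 1, k ≥ 1, and let a, b₁, ..., b_C be C + 1 pairwise distinct memory blocks. Let σ be the access sequence consisting of n accesses to b₁, followed by k copies of (b₁, b₂, ..., b_C), followed by n accesses to a. Then an LRU cache of capacity C starting from the empty state satisfies misses(σ, ∅) = C + 1. (This is the access pattern of the sequential execution of the lower-bound DAG of Theorem 5 — nodes x₁,...,xₙ accessing m₁, then the blocks Zₙ,...,Z₁ each accessing m₁,...,m_C, then the join nodes yₙ,...,y₁ accessing m_{C+1} — which incurs only O(C) cache misses.) -/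
variable {α : Type*} [DecidableEq α]

theorem lruMisses_append {α : Type*} [DecidableEq α] (C : ℕ) (σ τ s : List α) :
    lruMisses C (σ ++ τ) s = lruMisses C σ s + lruMisses C τ (lruRun C σ s) := by
  induction σ generalizing s with
  | nil => simp [lruMisses, lruRun]
  | cons x σ ih => simp [lruMisses, lruRun, ih, add_assoc]

theorem lruAccess_of_card_le {α : Type*} [DecidableEq α] {C : ℕ} {x : α} {s : List α}
    (hs : s.Nodup) (h : (insert x s.toFinset).card ≤ C) :
    (lruAccess C x s).Nodup ∧ (lruAccess C x s).toFinset = insert x s.toFinset ∧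
      (lruAccess C x s).length = (if x ∈ s then 0 else 1) + s.length := by
  by_cases hx : x ∈ s
  · have hp : (x :: s.erase x).Perm s := (List.perm_cons_erase hx).symm
    simp only [lruAccess, if_pos hx]
    refine ⟨hp.nodup_iff.2 hs, ?_, by simpa using hp.length_eq⟩
    rw [List.toFinset_eq_of_perm _ _ hp, Finset.insert_eq_of_mem (List.mem_toFinset.2 hx)]
  · have hlen : (x :: s).length ≤ C := by
      rwa [← List.toFinset_card_of_nodup (List.nodup_cons.2 ⟨hx, hs⟩), List.toFinset_cons]
    simp only [lruAccess, if_neg hx, List.take_of_length_le hlen]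
    exact ⟨List.nodup_cons.2 ⟨hx, hs⟩, List.toFinset_cons, by simp [add_comm]⟩

/-- As long as the blocks involved fit into the cache, nothing is evicted, so the misses are
exactly the first accesses to blocks that are not yet cached. -/
theorem lruMisses_of_card_le {α : Type*} [DecidableEq α] {C : ℕ} (σ : List α) {s : List α}
    (hs : s.Nodup) (h : (s.toFinset ∪ σ.toFinset).card ≤ C) :
    lruMisses C σ s + s.length = (s.toFinset ∪ σ.toFinset).card ∧
      (lruRun C σ s).toFinset = s.toFinset ∪ σ.toFinset := by
  induction σ generalizing s with
  | nil => simp [lruMisses, lruRun, List.toFinset_card_of_nodup hs]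
  | cons x σ ih =>
    have hunion : s.toFinset ∪ (x :: σ).toFinset = insert x s.toFinset ∪ σ.toFinset := by
      simp
    rw [hunion] at h ⊢
    obtain ⟨hnd, hset, hlen⟩ :=
      lruAccess_of_card_le hs ((Finset.card_le_card Finset.subset_union_left).trans h)
    obtain ⟨hm, hr⟩ := ih hnd (by rwa [hset])
    rw [hset] at hm hr
    refine ⟨?_, hr⟩
    simp only [lruMisses]
    lia

theorem lruMisses_replicate_of_head {α : Type*} [DecidableEq α] (C n : ℕ) (a : α) (s : List α) :
    lruMisses C (List.replicate n a) (a :: s) = 0 := by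
  induction n with
  | zero => rfl
  | succ n ih => simp [List.replicate_succ, lruMisses, lruAccess, ih]

theorem lruMisses_replicate_of_notMem {α : Type*} [DecidableEq α] {C n : ℕ} (hC : 1 ≤ C)
    (hn : 1 ≤ n) {a : α} {s : List α} (ha : a ∉ s) :
    lruMisses C (List.replicate n a) s = 1 := by
  obtain ⟨C, rfl⟩ := Nat.exists_eq_add_of_le' hC
  obtain ⟨n, rfl⟩ := Nat.exists_eq_add_of_le' hn
  simp [List.replicate_succ, lruMisses, lruAccess, ha, lruMisses_replicate_of_head]

theorem mem_listReps {α : Type*} {l : List α} {k : ℕ} (hk : 1 ≤ k) {x : α} :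
    x ∈ listReps l k ↔ x ∈ l := by
  induction k, hk using Nat.le_induction with
  | base => simp [listReps]
  | succ k _ ih => simp [listReps, ih]

/-- The access pattern of the sequential execution of the lower-bound DAG of
Theorem 5: `n` accesses to `b₁`, then `k` repetitions of `(b₁, …, b_C)`, then
`n` accesses to `a`, where `a, b₁, …, b_C` are `C + 1` pairwise distinct
blocks, incur exactly `C + 1` misses on an initially empty LRU cache of
capacity `C ≥ 1` (with `n, k ≥ 1`). -/
theorem lru_sequential_pattern_thm5_misses {α : Type*} [DecidableEq α]
    (C : ℕ) (hC : 1 ≤ C) (n k : ℕ) (hn : 1 ≤ n) (hk : 1 ≤ k)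
    (a : α) (b : Fin C → α)
    (hb : Function.Injective b) (hab : ∀ i, a ≠ b i) :
    lruMisses C
        (List.replicate n (b ⟨0, hC⟩) ++ listReps (List.ofFn b) k ++
          List.replicate n a)
        ([] : List α)
      = C + 1 := by
  have hset : (List.replicate n (b ⟨0, hC⟩) ++ listReps (List.ofFn b) k).toFinset =
      Finset.univ.image b := by
    ext x
    simp only [List.mem_toFinset, List.mem_append, List.mem_replicate, mem_listReps hk,
      List.mem_ofFn, Finset.mem_image, Finset.mem_univ, true_and]
    exact ⟨fun h => h.elim (fun h => ⟨_, h.2.symm⟩) id, Or.inr⟩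
  have hcard : (Finset.univ.image b).card = C := by
    rw [Finset.card_image_of_injective _ hb, Finset.card_univ, Fintype.card_fin]
  obtain ⟨hm, hr⟩ := lruMisses_of_card_le (C := C)
    (List.replicate n (b ⟨0, hC⟩) ++ listReps (List.ofFn b) k) (List.nodup_nil)
    (by simp [hset, hcard])
  rw [List.toFinset_nil, Finset.empty_union, hset] at hm hr
  rw [hcard, List.length_nil, add_zero] at hm
  rw [lruMisses_append, hm, lruMisses_replicate_of_notMem hC hn]
  rw [← List.mem_toFinset, hr]
  simpa using fun i => (hab i).symm
end

section
/- Let C ≥ 1. For every finite access sequence σ and every two cache states s₁ and s₂ of an LRU cache of capacity C, misses(σ, s₁) ≤ misses(σ, s₂) + C. That is, changing the initial cache contents changes the number of LRU misses on a fixed access sequence by at most C. (This is the property of the LRU policy, due to Acar, Blelloch and Blumofe and used throughout the paper, by which each deviation in a parallel execution can cause at most C additional cache misses, so that the number of additional cache misses is bounded by C times the number of deviations.) -/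
variable {α : Type*} [DecidableEq α]

theorem length_lruAccess_le {C : ℕ} (b : α) {s : List α} (h : s.length ≤ C) :
    (lruAccess C b s).length ≤ C := by
  unfold lruAccess
  split_ifs with hb
  · have := List.length_pos_of_mem hb
    simp only [List.length_cons, List.length_erase_of_mem hb]
    omega
  · simp

theorem length_lruAccess_of_mem {C : ℕ} {b : α} {s : List α} (hb : b ∈ s) :
    (lruAccess C b s).length = s.length := by
  have := List.length_pos_of_mem hb
  simp only [lruAccess, if_pos hb, List.length_cons, List.length_erase_of_mem hb]
  omega

theorem length_lruAccess_of_notMem {C : ℕ} {b : α} {s : List α} (hb : b ∉ s) :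
    (lruAccess C b s).length = min C (s.length + 1) := by
  simp [lruAccess, hb]

/-- An LRU access is monotone for the prefix order on cache states. -/
theorem lruAccess_prefix (C : ℕ) (b : α) {p s : List α} (h : p <+: s) :
    lruAccess C b p <+: lruAccess C b s := by
  obtain ⟨t, rfl⟩ := h
  by_cases hp : b ∈ p
  · simp [lruAccess, hp, List.erase_append_left]
  · by_cases ht : b ∈ t
    · simp only [lruAccess, hp, ht, List.mem_append, or_true, if_true, if_false,
        List.erase_append_right _ hp]
      exact (List.take_prefix _ _).trans (List.prefix_append (b :: p) _)
    · simp only [lruAccess, hp, ht, List.mem_append, or_self, if_false]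
      exact List.IsPrefix.take (List.prefix_append (b :: p) t) C

/-- Two cache states with a common prefix `p` differ by at most `C - p.length` misses. -/
theorem lruMisses_le_add_of_prefix (C : ℕ) (σ : List α) {p s₁ s₂ : List α}
    (h₁ : p <+: s₁) (h₂ : p <+: s₂) (hs : s₂.length ≤ C) :
    lruMisses C σ s₁ ≤ lruMisses C σ s₂ + (C - p.length) := by
  induction σ generalizing p s₁ s₂ with
  | nil => simp [lruMisses]
  | cons b σ ih =>
    have key := ih (lruAccess_prefix C b h₁) (lruAccess_prefix C b h₂)
      (length_lruAccess_le b hs)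
    simp only [lruMisses]
    by_cases hp : b ∈ p
    · rw [length_lruAccess_of_mem hp] at key
      simp only [h₁.subset hp, h₂.subset hp, if_true]
      omega
    · rw [length_lruAccess_of_notMem hp] at key
      by_cases hb : b ∈ s₂
      · have hlt : p.length < s₂.length := by
          refine lt_of_le_of_ne h₂.length_le fun he => hp ?_
          rwa [h₂.eq_of_length he]
        split_ifs <;> omega
      · have := h₂.length_le
        split_ifs <;> omega

/-- Changing the initial contents of an LRU cache of capacity `C ≥ 1` changes
the number of misses on a fixed access sequence by at most `C`: for all valid
cache states `s₁, s₂` (pairwise distinct blocks, length at most `C`) and every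
access sequence `σ`, `misses(σ, s₁) ≤ misses(σ, s₂) + C`. -/
theorem lru_misses_initial_state_diff_le {α : Type*} [DecidableEq α]
    (C : ℕ) (hC : 1 ≤ C) (σ : List α) (s₁ s₂ : List α)
    (h₁nodup : s₁.Nodup) (h₁len : s₁.length ≤ C)
    (h₂nodup : s₂.Nodup) (h₂len : s₂.length ≤ C) :
    lruMisses C σ s₁ ≤ lruMisses C σ s₂ + C := by
  simpa using lruMisses_le_add_of_prefix C σ s₁.nil_prefix s₂.nil_prefix h₂len
end
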